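/- Define the map T : ℝ^{m×n} → ℝ^{m×n} coordinatewise by T_{kj}(y) = min{ y_{kj}, h(y_k) − A_{kj}(y) }. Then an EFX allocation exists if and only if T admits a fixed point, i.e., there exists y* ∈ ℝ^{m×n} with T(y*) = y*. -/

import Mathlib

/-- Max of a row: `h(z) = max_r z_r` (realized as `sSup` of the finite range). -/
noncomputable def rowMax {n : ℕ} (z : Fin n → ℝ) : ℝ := sSup (Set.range z)

/-- The continuous-extension upper bound `g(x,λ)` from the paper. -/
noncomputable def gfun {m n : ℕ} (v x : Fin m → Fin n → ℝ) (lam : ℝ) : ℝ :=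
  (1 / lam) * Real.log
    (∑ p ∈ Finset.univ.filter (fun p : Fin n × Fin n => p.1 ≠ p.2),
      ∑ k : Fin m, x k p.2 *
        ∏ ℓ ∈ Finset.univ.erase k,
          (1 - x ℓ p.1 - x ℓ p.2 + x ℓ p.1 * Real.exp (-lam * v ℓ p.1)
            + x ℓ p.2 * Real.exp (lam * v ℓ p.1)))

/-- `X` is an EFX allocation: a partition of the goods such that for all agents
`i, j` and every good `k ∈ X_j`, `Σ_{ℓ∈X_i} v_{ℓi} ≥ Σ_{ℓ∈X_j} v_{ℓi} − v_{ki}`. -/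
def IsEFX {m n : ℕ} (v : Fin m → Fin n → ℝ) (X : Fin n → Finset (Fin m)) : Prop :=
  (∀ i j, i ≠ j → Disjoint (X i) (X j)) ∧
  (Finset.univ.biUnion X = (Finset.univ : Finset (Fin m))) ∧
  (∀ i j : Fin n, ∀ k ∈ X j, (∑ ℓ ∈ X i, v ℓ i) ≥ (∑ ℓ ∈ X j, v ℓ i) - v k i)

/-- `A_{kj}(y) = max_{i≠j} Σ_{ℓ≠k} ( h(y_ℓ + v_{ℓi}(e_j − e_i)) − h(y_ℓ) )`. -/
noncomputable def Amap {m n : ℕ} (v y : Fin m → Fin n → ℝ) (k : Fin m) (j : Fin n) : ℝ :=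
  sSup { z : ℝ | ∃ i : Fin n, i ≠ j ∧
    z = ∑ ℓ ∈ Finset.univ.erase k,
      (rowMax (fun r => y ℓ r +
          v ℓ i * ((if r = j then (1 : ℝ) else 0) - (if r = i then (1 : ℝ) else 0)))
        - rowMax (y ℓ)) }

/-- The objective `f(y)` of Theorem `thm:f-y`; note that
`max{ y_{ℓi} − v_{ℓi}, y_{ℓj} + v_{ℓi}, max_{r∉{i,j}} y_{ℓr} }` is exactly the max of
the row `y_ℓ + v_{ℓi}(e_j − e_i)` (and when `n = 2` the innermost max is absent). -/
noncomputable def fobj {m n : ℕ} (v y : Fin m → Fin n → ℝ) : ℝ :=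
  sSup { z : ℝ | ∃ i j : Fin n, i ≠ j ∧ ∃ k : Fin m,
      z = y k j + ∑ ℓ ∈ Finset.univ.erase k,
        rowMax (fun r => y ℓ r +
          v ℓ i * ((if r = j then (1 : ℝ) else 0) - (if r = i then (1 : ℝ) else 0))) }
    - ∑ ℓ, rowMax (y ℓ)

theorem le_rowMax {n : ℕ} (z : Fin n → ℝ) (r : Fin n) : z r ≤ rowMax z :=
  le_csSup (Set.finite_range z).bddAbove ⟨r, rfl⟩

theorem exists_eq_rowMax {n : ℕ} [NeZero n] (z : Fin n → ℝ) : ∃ r, z r = rowMax z :=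
  (Set.range_nonempty z).csSup_mem (Set.finite_range z)

theorem rowMax_eq_of_forall_le {n : ℕ} {z : Fin n → ℝ} {r : Fin n} (h : ∀ s, z s ≤ z r) :
    rowMax z = z r :=
  le_antisymm (csSup_le ⟨z r, r, rfl⟩ (by rintro _ ⟨s, rfl⟩; exact h s)) (le_rowMax z r)

/-- The sum whose maximum over `i ≠ j` is `Amap v y k j`. -/
noncomputable def transferGain {m n : ℕ} (v y : Fin m → Fin n → ℝ) (k : Fin m)
    (i j : Fin n) : ℝ :=
  ∑ ℓ ∈ Finset.univ.erase k,
    (rowMax (fun r => y ℓ r +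
        v ℓ i * ((if r = j then (1 : ℝ) else 0) - (if r = i then (1 : ℝ) else 0)))
      - rowMax (y ℓ))

theorem transferGain_le_Amap {m n : ℕ} (v y : Fin m → Fin n → ℝ) (k : Fin m) {i j : Fin n}
    (hij : i ≠ j) : transferGain v y k i j ≤ Amap v y k j := by
  refine le_csSup (Set.Finite.bddAbove ?_) ⟨i, hij, rfl⟩
  refine (Set.finite_range fun i => transferGain v y k i j).subset ?_
  rintro _ ⟨i, -, rfl⟩
  exact ⟨i, rfl⟩

theorem Amap_le {m n : ℕ} (hn : 2 ≤ n) {v y : Fin m → Fin n → ℝ} {k : Fin m} {j : Fin n} {c : ℝ}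
    (h : ∀ i, i ≠ j → transferGain v y k i j ≤ c) : Amap v y k j ≤ c := by
  have : Nontrivial (Fin n) := Fin.nontrivial_iff_two_le.2 hn
  obtain ⟨i, hi⟩ := exists_ne j
  refine csSup_le ⟨_, i, hi, rfl⟩ ?_
  rintro _ ⟨i, hi, rfl⟩
  exact h i hi

/-- A choice of a maximal coordinate in every row is a subgradient of the row maxima. -/
theorem sum_le_transferGain {m n : ℕ} (v y : Fin m → Fin n → ℝ) (a : Fin m → Fin n)
    (ha : ∀ ℓ, y ℓ (a ℓ) = rowMax (y ℓ)) (k : Fin m) (i j : Fin n) :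
    ∑ ℓ ∈ Finset.univ.erase k,
        v ℓ i * ((if a ℓ = j then (1 : ℝ) else 0) - (if a ℓ = i then (1 : ℝ) else 0))
      ≤ transferGain v y k i j := by
  refine Finset.sum_le_sum fun ℓ _ => ?_
  have := le_rowMax (fun r => y ℓ r +
    v ℓ i * ((if r = j then (1 : ℝ) else 0) - (if r = i then (1 : ℝ) else 0))) (a ℓ)
  simp only [ha] at this
  linarith

theorem sum_erase_indicator_sub {m n : ℕ} (v : Fin m → Fin n → ℝ) (a : Fin m → Fin n)
    (k : Fin m) {i j : Fin n} (hij : i ≠ j) (hk : a k = j) :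
    ∑ ℓ ∈ Finset.univ.erase k,
        v ℓ i * ((if a ℓ = j then (1 : ℝ) else 0) - (if a ℓ = i then (1 : ℝ) else 0))
      = (∑ ℓ ∈ Finset.univ.filter (a · = j), v ℓ i) - v k i
        - ∑ ℓ ∈ Finset.univ.filter (a · = i), v ℓ i := by
  rw [Finset.sum_erase_eq_sub (Finset.mem_univ k)]
  simp only [mul_sub, Finset.sum_sub_distrib, mul_ite, mul_one, mul_zero, Finset.sum_filter,
    hk, if_true, hij.symm, if_false]
  ring

theorem isEFX_filter_iff {m n : ℕ} (v : Fin m → Fin n → ℝ) (hv : ∀ k i, 0 ≤ v k i)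
    (a : Fin m → Fin n) :
    IsEFX v (fun j => Finset.univ.filter (a · = j)) ↔
      ∀ i j k, i ≠ j → a k = j → ∑ ℓ ∈ Finset.univ.erase k,
        v ℓ i * ((if a ℓ = j then (1 : ℝ) else 0) - (if a ℓ = i then (1 : ℝ) else 0)) ≤ 0 := by
  constructor
  · rintro ⟨-, -, h⟩ i j k hij hk
    rw [sum_erase_indicator_sub v a k hij hk]
    linarith [h i j k (by simpa using hk)]
  · refine fun h => ⟨fun i j hij => ?_, by ext; simp, fun i j k hk => ?_⟩
    · exact Finset.disjoint_filter.2 fun ℓ _ hi hj => hij (hi.symm.trans hj)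
    · rcases eq_or_ne i j with rfl | hij
      · linarith [hv k i]
      · have hk : a k = j := by simpa using hk
        have := h i j k hij hk
        rw [sum_erase_indicator_sub v a k hij hk] at this
        linarith

theorem IsEFX.exists_eq_filter {m n : ℕ} {v : Fin m → Fin n → ℝ} {X : Fin n → Finset (Fin m)}
    (h : IsEFX v X) : ∃ a : Fin m → Fin n, X = fun j => Finset.univ.filter (a · = j) := by
  have hex : ∀ k, ∃ j, k ∈ X j := fun k => by
    have : k ∈ Finset.univ.biUnion X := h.2.1 ▸ Finset.mem_univ k
    simpa using this
  choose a ha using hex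
  refine ⟨a, funext fun j => Finset.ext fun k => ?_⟩
  simp only [Finset.mem_filter, Finset.mem_univ, true_and]
  refine ⟨fun hk => ?_, fun hk => hk ▸ ha k⟩
  by_contra hne
  exact Finset.disjoint_left.1 (h.1 _ _ hne) (ha k) hk

theorem rowMax_single {n : ℕ} (a : Fin n) {c : ℝ} (hc : 0 ≤ c) :
    rowMax (fun r => if r = a then c else 0) = c := by
  rw [rowMax_eq_of_forall_le (r := a)]
  · simp
  · intro s
    split_ifs <;> simp_all

theorem rowMax_single_add {n : ℕ} (a i j : Fin n) (hij : i ≠ j) {c w : ℝ} (hw : 0 ≤ w)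
    (hc : 2 * w ≤ c) :
    rowMax (fun r => (if r = a then c else 0) +
        w * ((if r = j then (1 : ℝ) else 0) - (if r = i then (1 : ℝ) else 0)))
      = c + w * ((if a = j then (1 : ℝ) else 0) - (if a = i then (1 : ℝ) else 0)) := by
  rw [rowMax_eq_of_forall_le (r := a)]
  · simp
  · intro s
    simp only [if_true]
    split_ifs <;> subst_vars <;> first | linarith | exact absurd rfl ‹_›

/-- On the rows encoding the assignment `a` with large height `c`, the row maxima are affine. -/
theorem transferGain_single {m n : ℕ} (v : Fin m → Fin n → ℝ) (hv : ∀ k i, 0 ≤ v k i)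
    (a : Fin m → Fin n) {c : ℝ} (hc : ∀ k i, 2 * v k i ≤ c) (k : Fin m) {i j : Fin n}
    (hij : i ≠ j) :
    transferGain v (fun ℓ r => if r = a ℓ then c else 0) k i j
      = ∑ ℓ ∈ Finset.univ.erase k,
        v ℓ i * ((if a ℓ = j then (1 : ℝ) else 0) - (if a ℓ = i then (1 : ℝ) else 0)) := by
  refine Finset.sum_congr rfl fun ℓ _ => ?_
  have hc0 : 0 ≤ c := by linarith [hc ℓ i, hv ℓ i]
  rw [rowMax_single_add (a ℓ) i j hij (hv ℓ i) (hc ℓ i), rowMax_single (a ℓ) hc0]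
  ring

/-- Define `T : ℝ^{m×n} → ℝ^{m×n}` coordinatewise by
`T_{kj}(y) = min{ y_{kj}, h(y_k) − A_{kj}(y) }`. Then an EFX allocation exists if
and only if `T` admits a fixed point. -/
theorem stmt_14 (m n : ℕ) (hm : 1 ≤ m) (hn : 2 ≤ n)
    (v : Fin m → Fin n → ℝ) (hv : ∀ k i, 0 ≤ v k i) :
    (∃ X : Fin n → Finset (Fin m), IsEFX v X) ↔
      (∃ y : Fin m → Fin n → ℝ,
        (fun (k : Fin m) (j : Fin n) =>
          min (y k j) (rowMax (y k) - Amap v y k j)) = y) := by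
  have : NeZero n := ⟨by omega⟩
  simp only [funext_iff, min_eq_left_iff]
  constructor
  · rintro ⟨X, hX⟩
    obtain ⟨a, rfl⟩ := hX.exists_eq_filter
    rw [isEFX_filter_iff v hv] at hX
    set c : ℝ := 2 * ∑ ℓ, ∑ i, v ℓ i with hc_def
    have hle (k : Fin m) (i : Fin n) : v k i ≤ ∑ i, v k i :=
      Finset.single_le_sum (fun i _ => hv k i) (Finset.mem_univ i)
    have hrow (k : Fin m) : 0 ≤ ∑ i, v k i := Finset.sum_nonneg fun i _ => hv k i
    have hc0 : 0 ≤ c := mul_nonneg zero_le_two (Finset.sum_nonneg fun k _ => hrow k)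
    have hc (k : Fin m) (i : Fin n) : 2 * v k i ≤ c := by
      have := Finset.single_le_sum (fun k _ => hrow k) (Finset.mem_univ k)
      linarith [hle k i]
    refine ⟨fun ℓ r => if r = a ℓ then c else 0, fun k j => ?_⟩
    rw [rowMax_single (a k) hc0, le_sub_comm]
    refine Amap_le hn fun i hij => ?_
    rw [transferGain_single v hv a hc k hij]
    by_cases hk : j = a k
    · simpa [hk] using hX i j k hij hk.symm
    · simp only [hk, if_false, sub_zero]
      calc _ ≤ ∑ ℓ ∈ Finset.univ.erase k, v ℓ i := by
            refine Finset.sum_le_sum fun ℓ _ => mul_le_of_le_one_right (hv ℓ i) ?_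
            split_ifs <;> norm_num
        _ ≤ ∑ ℓ, v ℓ i :=
            Finset.sum_le_sum_of_subset_of_nonneg (Finset.erase_subset _ _) fun ℓ _ _ => hv ℓ i
        _ ≤ ∑ ℓ, ∑ i, v ℓ i := Finset.sum_le_sum fun ℓ _ => hle ℓ i
        _ ≤ c := by linarith
  · rintro ⟨y, hy⟩
    choose a ha using fun ℓ => exists_eq_rowMax (y ℓ)
    refine ⟨_, (isEFX_filter_iff v hv a).2 fun i j k hij hk => ?_⟩
    have h1 := hy k j
    rw [← hk, ha k, hk] at h1
    linarith [sum_le_transferGain v y a ha k i j, transferGain_le_Amap v y k hij]
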